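/- Let Γ be a group with a finite symmetric generating set S whose word balls satisfy |B(n)| ≤ C·n^d for all n ≥ 1, for some constants C > 0 and d ≥ 0, and let Γ act by homeomorphisms on a nonempty compact metrizable space X. Then for every open subset A ⊆ X there exists a Γ-invariant Borel probability measure ν on X such that ν(A) ≤ liminf_{n→∞} inf_{x∈X} (1/|B(n)|)·∑_{g∈B(n)} 1_A(g·x). -/

import Mathlib

open MeasureTheory Filter Topology

/-- The word ball of radius `n` with respect to a generating set `S`:
elements expressible as a product of at most `n` elements of `S` (so `B 0 = {1}`). -/
def wordBall {Γ : Type*} [Group Γ] (S : Set Γ) (n : ℕ) : Set Γ :=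
  {g : Γ | ∃ l : List Γ, (∀ x ∈ l, x ∈ S) ∧ l.length ≤ n ∧ l.prod = g}

section WordBall

variable {Γ : Type*} [Group Γ] {S : Set Γ}

theorem one_mem_wordBall (S : Set Γ) (n : ℕ) : (1 : Γ) ∈ wordBall S n :=
  ⟨[], by simp, by simp, by simp⟩

theorem mem_wordBall_one {s : Γ} (hs : s ∈ S) : s ∈ wordBall S 1 :=
  ⟨[s], by simpa using hs, by simp, by simp⟩

theorem wordBall_mono (S : Set Γ) : Monotone (wordBall S) := by
  rintro m n hmn g ⟨l, hl, hlen, rfl⟩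
  exact ⟨l, hl, hlen.trans hmn, rfl⟩

theorem mul_mem_wordBall {m n : ℕ} {g h : Γ} (hg : g ∈ wordBall S m) (hh : h ∈ wordBall S n) :
    g * h ∈ wordBall S (m + n) := by
  obtain ⟨l, hl, hlen, rfl⟩ := hg
  obtain ⟨l', hl', hlen', rfl⟩ := hh
  refine ⟨l ++ l', ?_, by simp; omega, by simp⟩
  intro x hx
  rcases List.mem_append.1 hx with hx | hx
  exacts [hl x hx, hl' x hx]

theorem inv_mem_wordBall (hsym : S⁻¹ = S) {n : ℕ} {g : Γ} (hg : g ∈ wordBall S n) :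
    g⁻¹ ∈ wordBall S n := by
  obtain ⟨l, hl, hlen, rfl⟩ := hg
  refine ⟨(l.map fun x => x⁻¹).reverse, ?_, by simpa using hlen, (List.prod_inv_reverse l).symm⟩
  intro x hx
  simp only [List.mem_reverse, List.mem_map] at hx
  obtain ⟨y, hy, rfl⟩ := hx
  rw [← hsym]
  simpa using hl y hy

theorem exists_mul_of_mem_wordBall_add {m n : ℕ} {g : Γ} (hg : g ∈ wordBall S (m + n)) :
    ∃ a ∈ wordBall S m, ∃ b ∈ wordBall S n, a * b = g := by
  obtain ⟨l, hl, hlen, rfl⟩ := hg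
  exact ⟨(l.take m).prod, ⟨l.take m, fun x hx => hl x (List.mem_of_mem_take hx), by simp, rfl⟩,
    (l.drop m).prod, ⟨l.drop m, fun x hx => hl x (List.mem_of_mem_drop hx), by simp; omega, rfl⟩,
    List.prod_take_mul_prod_drop l m⟩

theorem finite_wordBall (hfin : S.Finite) (n : ℕ) : (wordBall S n).Finite := by
  induction n with
  | zero =>
    refine (Set.finite_singleton (1 : Γ)).subset ?_
    rintro g ⟨l, -, hlen, rfl⟩
    simp [List.length_eq_zero_iff.1 (Nat.le_zero.1 hlen)]
  | succ n ih =>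
    have hone : (wordBall S 1).Finite := by
      refine (hfin.insert 1).subset ?_
      rintro g ⟨l, hl, hlen, rfl⟩
      match l with
      | [] => simp
      | [x] => simpa using Or.inr (hl x (by simp))
      | x :: y :: l => simp at hlen
    refine (Set.Finite.image2 (fun a b => a * b) ih hone).subset ?_
    intro g hg
    obtain ⟨a, ha, b, hb, rfl⟩ := exists_mul_of_mem_wordBall_add hg
    exact ⟨a, ha, b, hb, rfl⟩

theorem ncard_wordBall_pos (hfin : S.Finite) (n : ℕ) : 0 < (wordBall S n).ncard :=
  (Set.ncard_pos (finite_wordBall hfin n)).2 ⟨1, one_mem_wordBall S n⟩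

theorem ncard_wordBall_mono (hfin : S.Finite) : Monotone fun n => (wordBall S n).ncard :=
  fun _ n hmn => Set.ncard_le_ncard (wordBall_mono S hmn) (finite_wordBall hfin n)

/-- The number of elements of the outer layer of width `r` of a word ball. -/
theorem ncard_wordBall_diff (hfin : S.Finite) (n r : ℕ) :
    ((wordBall S n \ wordBall S (n - r)).ncard : ℝ) =
      (wordBall S n).ncard - (wordBall S (n - r)).ncard :=
  Set.cast_ncard_sdiff (wordBall_mono S (Nat.sub_le n r)) (finite_wordBall hfin n)

/-- Every point of the outer layer of width `r` is within `3 * r` of a whole ball of radius `r`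
contained in the next layer of width `3 * r`; count the pairs. -/
theorem ncard_layer_mul_le (hfin : S.Finite) (hsym : S⁻¹ = S) {n r : ℕ} (hn : 4 * r ≤ n) :
    (wordBall S n \ wordBall S (n - r)).ncard * (wordBall S r).ncard ≤
      (wordBall S (n - r) \ wordBall S (n - 4 * r)).ncard * (wordBall S (3 * r)).ncard := by
  classical
  have hs := (finite_wordBall hfin n).sdiff (t := wordBall S (n - r))
  have ht := (finite_wordBall hfin (n - r)).sdiff (t := wordBall S (n - 4 * r))
  rw [Set.ncard_eq_toFinset_card _ hs, Set.ncard_eq_toFinset_card _ ht]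
  refine Finset.card_mul_le_card_mul (fun g y => g⁻¹ * y ∈ wordBall S (3 * r)) ?_ ?_
  · intro g hg
    rw [Set.Finite.mem_toFinset] at hg
    obtain ⟨a, ha, b, hb, rfl⟩ := exists_mul_of_mem_wordBall_add (m := n - 2 * r) (n := 2 * r)
      (g := g) (by rw [show n - 2 * r + 2 * r = n by omega]; exact hg.1)
    rw [← Set.ncard_image_of_injective _ (mul_right_injective a), ← Set.ncard_coe_finset]
    refine Set.ncard_le_ncard ?_ (Finset.finite_toSet _)
    rintro _ ⟨c, hc, rfl⟩
    simp only [Finset.mem_coe, Finset.mem_bipartiteAbove, Set.Finite.mem_toFinset]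
    refine ⟨⟨?_, fun hac => hg.2 ?_⟩, ?_⟩
    · exact wordBall_mono S (by omega) (mul_mem_wordBall ha hc)
    · have := mul_mem_wordBall (mul_mem_wordBall hac (inv_mem_wordBall hsym hc)) hb
      rw [mul_inv_cancel_right] at this
      exact wordBall_mono S (by omega) this
    · have := mul_mem_wordBall (inv_mem_wordBall hsym hb) hc
      rw [show (a * b)⁻¹ * (a * c) = b⁻¹ * c by group]
      exact wordBall_mono S (by omega) this
  · intro y _
    rw [← Set.ncard_image_of_injective _ (mul_right_injective y), ← Set.ncard_coe_finset]
    refine Set.ncard_le_ncard ?_ ((finite_wordBall hfin _).image _)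
    intro g hg
    simp only [Finset.mem_coe, Finset.mem_bipartiteBelow] at hg
    exact ⟨y⁻¹ * g, by simpa using inv_mem_wordBall hsym hg.2, mul_inv_cancel_left y g⟩

/-- Under polynomial growth, word balls are doubling at arbitrarily large scales. -/
theorem frequently_ncard_wordBall_le (hfin : S.Finite) {C d : ℝ}
    (hpoly : ∀ n : ℕ, 1 ≤ n → ((wordBall S n).ncard : ℝ) ≤ C * (n : ℝ) ^ d) :
    ∃ᶠ k : ℕ in atTop, ((wordBall S (4 ^ (k + 1))).ncard : ℝ) ≤
      2 * (4 : ℝ) ^ d * (wordBall S (4 ^ k)).ncard := by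
  intro hev
  obtain ⟨k, hk⟩ := eventually_atTop.1 hev
  have hgrow : ∀ j : ℕ, (2 * (4 : ℝ) ^ d) ^ j ≤ (wordBall S (4 ^ (k + j))).ncard := by
    intro j
    induction j with
    | zero => simpa using Nat.one_le_iff_ne_zero.2 (ncard_wordBall_pos hfin (4 ^ k)).ne'
    | succ j ih =>
      have h := not_le.1 (hk (k + j) (by omega))
      rw [pow_succ']
      exact (mul_le_mul_of_nonneg_left ih (by positivity)).trans h.le
  have hbound : ∀ j : ℕ, (2 : ℝ) ^ j ≤ C * ((4 : ℝ) ^ d) ^ k := by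
    intro j
    have h := (hgrow j).trans (hpoly (4 ^ (k + j)) (Nat.one_le_pow _ _ (by norm_num)))
    rw [Nat.cast_pow, Nat.cast_ofNat, ← Real.rpow_pow_comm (by norm_num), mul_pow, pow_add,
      ← mul_assoc] at h
    exact le_of_mul_le_mul_right h (by positivity)
  obtain ⟨j, hj⟩ := pow_unbounded_of_one_lt (C * ((4 : ℝ) ^ d) ^ k) (one_lt_two (α := ℝ))
  exact absurd (hbound j) (not_le.2 hj)

theorem exists_forall_pow_mul_ncard_layer_le (hfin : S.Finite) (hsym : S⁻¹ = S) {K : ℝ}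
    (hK : 0 < K) (hdouble : ∃ᶠ k : ℕ in atTop,
      ((wordBall S (4 ^ (k + 1))).ncard : ℝ) ≤ K * (wordBall S (4 ^ k)).ncard) (j : ℕ) :
    ∃ k : ℕ, ∀ n : ℕ, 4 ^ k ≤ n →
      (1 + K⁻¹) ^ j * (((wordBall S n).ncard : ℝ) - (wordBall S (n - 1)).ncard) ≤
        (wordBall S n).ncard - (wordBall S (n - 4 ^ k)).ncard := by
  induction j with
  | zero => exact ⟨0, fun n _ => by simp⟩
  | succ j ih =>
    obtain ⟨k, hk⟩ := ih
    obtain ⟨m, hkm, hm⟩ := frequently_atTop.1 hdouble k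
    refine ⟨m + 1, fun n hn => ?_⟩
    have hkm' : 4 ^ k ≤ 4 ^ m := Nat.pow_le_pow_right (by norm_num) hkm
    have hm4 : 4 ^ (m + 1) = 4 * 4 ^ m := pow_succ' 4 m
    have hn' : 4 * 4 ^ m ≤ n := hm4 ▸ hn
    have hlayer := ncard_layer_mul_le hfin hsym hn'
    have hsub : n - 4 * 4 ^ m = n - 4 ^ m - 3 * 4 ^ m := by omega
    have hthree : ((wordBall S (3 * 4 ^ m)).ncard : ℝ) ≤ K * (wordBall S (4 ^ m)).ncard :=
      le_trans (by exact_mod_cast ncard_wordBall_mono hfin (by omega)) hm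
    have hpos : (0 : ℝ) < (wordBall S (4 ^ m)).ncard := by
      exact_mod_cast ncard_wordBall_pos hfin _
    rw [hsub] at hlayer
    have hlayer' : ((wordBall S n).ncard - (wordBall S (n - 4 ^ m)).ncard : ℝ) ≤
        K * ((wordBall S (n - 4 ^ m)).ncard - (wordBall S (n - 4 ^ (m + 1))).ncard) := by
      rw [hm4, hsub, ← ncard_wordBall_diff hfin, ← ncard_wordBall_diff hfin]
      refine le_of_mul_le_mul_right ?_ hpos
      calc _ ≤ ((wordBall S (n - 4 ^ m) \ wordBall S (n - 4 ^ m - 3 * 4 ^ m)).ncard : ℝ) *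
            (wordBall S (3 * 4 ^ m)).ncard := by exact_mod_cast hlayer
        _ ≤ _ := by
          refine (mul_le_mul_of_nonneg_left hthree (by positivity)).trans (le_of_eq ?_)
          ring
    have hj := hk n (by omega)
    have hmono : ((wordBall S (n - 4 ^ m)).ncard : ℝ) ≤ (wordBall S (n - 4 ^ k)).ncard := by
      exact_mod_cast ncard_wordBall_mono hfin (by omega)
    have hinv := mul_le_mul_of_nonneg_left hlayer' (inv_nonneg.2 hK.le)
    rw [inv_mul_cancel_left₀ hK.ne'] at hinv
    calc _ = (1 + K⁻¹) * ((1 + K⁻¹) ^ j *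
          (((wordBall S n).ncard : ℝ) - (wordBall S (n - 1)).ncard)) := by ring
      _ ≤ (1 + K⁻¹) * ((wordBall S n).ncard - (wordBall S (n - 4 ^ m)).ncard) := by
        gcongr
        linarith
      _ ≤ _ := by linarith

/-- In a group of polynomial growth, spheres are negligible in balls. -/
theorem tendsto_ncard_layer_div (hfin : S.Finite) (hsym : S⁻¹ = S) {C d : ℝ}
    (hpoly : ∀ n : ℕ, 1 ≤ n → ((wordBall S n).ncard : ℝ) ≤ C * (n : ℝ) ^ d) :
    Tendsto (fun n : ℕ => ((wordBall S n \ wordBall S (n - 1)).ncard : ℝ) /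
      (wordBall S n).ncard) atTop (𝓝 0) := by
  set K : ℝ := 2 * (4 : ℝ) ^ d
  have hK : 0 < K := by positivity
  refine tendsto_order.2 ⟨fun a ha => Eventually.of_forall fun n => ha.trans_le (by positivity),
    fun ε hε => ?_⟩
  obtain ⟨j, hj⟩ := pow_unbounded_of_one_lt ε⁻¹ (lt_add_of_pos_right (1 : ℝ) (inv_pos.2 hK))
  obtain ⟨k, hk⟩ := exists_forall_pow_mul_ncard_layer_le hfin hsym hK
    (frequently_ncard_wordBall_le hfin hpoly) j
  filter_upwards [eventually_ge_atTop (4 ^ k)] with n hn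
  have hpos : (0 : ℝ) < (wordBall S n).ncard := by exact_mod_cast ncard_wordBall_pos hfin _
  have h := hk n hn
  rw [← ncard_wordBall_diff hfin] at h
  have h0 : (0 : ℝ) ≤ (wordBall S (n - 4 ^ k)).ncard := by positivity
  rw [div_lt_iff₀ hpos]
  have h1 : (0 : ℝ) ≤ (wordBall S n \ wordBall S (n - 1)).ncard := by positivity
  have hj' : 1 < ε * (1 + K⁻¹) ^ j := by
    rwa [inv_lt_iff_one_lt_mul₀ hε, mul_comm] at hj
  rcases h1.eq_or_lt with h1 | h1
  · rw [← h1]; positivity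
  · calc _ < (ε * (1 + K⁻¹) ^ j) * ((wordBall S n \ wordBall S (n - 1)).ncard : ℝ) :=
          lt_mul_of_one_lt_left h1 hj'
      _ ≤ _ := by
        rw [mul_assoc]
        gcongr
        linarith

theorem mem_image_mul_left_of_mem_wordBall (hsym : S⁻¹ = S) {s g : Γ} {n : ℕ} (hs : s ∈ S)
    (hn : 1 ≤ n) (hg : g ∈ wordBall S (n - 1)) : g ∈ (fun h => s * h) '' wordBall S n := by
  refine ⟨s⁻¹ * g, ?_, mul_inv_cancel_left s g⟩
  exact wordBall_mono S (by omega)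
    (mul_mem_wordBall (inv_mem_wordBall hsym (mem_wordBall_one hs)) hg)

end WordBall

section OrbitMeasure

variable {Γ : Type*} [Group Γ]

theorem abs_sum_mul_left_sub_sum_le [DecidableEq Γ] (F : Finset Γ) (s : Γ) (f : Γ → ℝ) {M : ℝ}
    (hf : ∀ g, |f g| ≤ M) :
    |∑ g ∈ F, f (s * g) - ∑ g ∈ F, f g| ≤ 2 * M * (F \ F.image (s * ·)).card := by
  have hbound : ∀ E : Finset Γ, |∑ g ∈ E, f g| ≤ M * E.card := fun E =>
    (Finset.abs_sum_le_sum_abs _ _).trans <|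
      (Finset.sum_le_card_nsmul _ _ _ fun g _ => hf g).trans (by simp [mul_comm])
  have hcard : (F.image (s * ·) \ F).card = (F \ F.image (s * ·)).card :=
    Finset.card_sdiff_comm (Finset.card_image_of_injective F (mul_right_injective s))
  rw [← Finset.sum_image (f := f) (g := (s * ·)) ((mul_right_injective s).injOn),
    ← Finset.sum_sdiff_sub_sum_sdiff]
  refine (abs_sub _ _).trans ?_
  have h1 := hbound (F.image (s * ·) \ F)
  have h2 := hbound (F \ F.image (s * ·))
  rw [hcard] at h1
  linarith

variable {X : Type*} [MeasurableSpace X] [MulAction Γ X]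

/-- The uniform distribution on the points `g • x`, for `g` in the finite set `F`,
counted with multiplicity. -/
noncomputable def orbitMeasure (F : Finset Γ) (x : X) : Measure X :=
  (F.card : ENNReal)⁻¹ • ∑ g ∈ F, Measure.dirac (g • x)

theorem isProbabilityMeasure_orbitMeasure {F : Finset Γ} (hF : F.Nonempty) (x : X) :
    IsProbabilityMeasure (orbitMeasure F x) := by
  constructor
  have h : (F.card : ENNReal) ≠ 0 := by simpa using hF.ne_empty
  simp [orbitMeasure, ENNReal.inv_mul_cancel h (ENNReal.natCast_ne_top _)]

theorem toReal_orbitMeasure_apply (F : Finset Γ) (x : X) {A : Set X} (hA : MeasurableSet A) :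
    (orbitMeasure F x A).toReal =
      1 / (F.card : ℝ) * ∑ g ∈ F, A.indicator (fun _ => (1 : ℝ)) (g • x) := by
  simp only [orbitMeasure, Measure.smul_apply, Measure.finsetSum_apply, smul_eq_mul,
    ENNReal.toReal_mul, ENNReal.toReal_inv, ENNReal.toReal_natCast, one_div,
    Measure.dirac_apply' _ hA]
  rw [ENNReal.toReal_sum]
  · congr 1
    refine Finset.sum_congr rfl fun g _ => ?_
    by_cases h : g • x ∈ A <;> simp [h]
  · intro g _
    by_cases h : g • x ∈ A <;> simp [h]

variable [TopologicalSpace X] [BorelSpace X]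

theorem integral_orbitMeasure (F : Finset Γ) (x : X) (f : BoundedContinuousFunction X ℝ) :
    ∫ y, f y ∂orbitMeasure F x = (F.card : ℝ)⁻¹ * ∑ g ∈ F, f (g • x) := by
  rw [orbitMeasure, integral_smul_measure, integral_finsetSum_measure]
  · simp [integral_dirac' _ _ f.continuous.stronglyMeasurable]
  · intro g _
    exact f.integrable _

/-- A weak limit of orbit measures over finite sets asymptotically invariant under `s` is
`s`-invariant. -/
theorem map_smul_eq_of_tendsto_orbitMeasure [DecidableEq Γ] [HasOuterApproxClosed X]
    {ι : Type*} {l : Filter ι} [l.NeBot]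
    {F : ι → Finset Γ} {x : ι → X} {μ : ι → ProbabilityMeasure X}
    (hμ : ∀ i, (μ i : Measure X) = orbitMeasure (F i) (x i)) {ν : ProbabilityMeasure X}
    (hν : Tendsto μ l (𝓝 ν)) {s : Γ} (hs : Continuous fun y : X => s • y)
    (hF : Tendsto (fun i => ((F i \ (F i).image (s * ·)).card : ℝ) / (F i).card) l (𝓝 0)) :
    Measure.map (fun y : X => s • y) ν = ν := by
  have : IsProbabilityMeasure (Measure.map (fun y : X => s • y) (ν : Measure X)) :=
    Measure.isProbabilityMeasure_map hs.aemeasurable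
  refine ext_of_forall_integral_eq_of_IsFiniteMeasure fun f => ?_
  rw [integral_map hs.aemeasurable f.continuous.aestronglyMeasurable]
  have hlim := ProbabilityMeasure.tendsto_iff_forall_integral_tendsto.1 hν
  have hdiff := (hlim (f.compContinuous ⟨_, hs⟩)).sub (hlim f)
  refine sub_eq_zero.1 (tendsto_nhds_unique hdiff ?_)
  have hF' := hF.const_mul (2 * ‖f‖)
  rw [mul_zero] at hF'
  refine squeeze_zero_norm (fun i => ?_) hF'
  rw [hμ, integral_orbitMeasure, integral_orbitMeasure, ← mul_sub, Real.norm_eq_abs, abs_mul,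
    abs_of_nonneg (by positivity), ← mul_div_assoc, div_eq_inv_mul]
  refine mul_le_mul_of_nonneg_left ?_ (by positivity)
  simpa [mul_smul] using abs_sum_mul_left_sub_sum_le (F i) s (fun g => f (g • x i))
    (fun g => f.norm_coe_le_norm _)

end OrbitMeasure

/-- For an action of a group of polynomial growth on a nonempty compact
metrizable space, the lower Banach density of an open set dominates its measure under
some invariant Borel probability measure. -/
theorem exists_invariant_measure_le_lower_density {Γ : Type*} [Group Γ]
    (S : Set Γ) (hfin : S.Finite) (hsym : S⁻¹ = S) (hgen : Subgroup.closure S = ⊤)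
    (C d : ℝ) (hC : 0 < C) (hd : 0 ≤ d)
    (hpoly : ∀ n : ℕ, 1 ≤ n → ((wordBall S n).ncard : ℝ) ≤ C * (n : ℝ) ^ d)
    {X : Type*} [TopologicalSpace X] [CompactSpace X]
    [TopologicalSpace.MetrizableSpace X] [Nonempty X]
    [MeasurableSpace X] [BorelSpace X]
    [MulAction Γ X] (hcont : ∀ g : Γ, Continuous fun x : X => g • x)
    (A : Set X) (hA : IsOpen A) :
    ∃ ν : Measure X, IsProbabilityMeasure ν ∧
      (∀ g : Γ, Measure.map (fun x : X => g • x) ν = ν) ∧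
      (ν A).toReal ≤
        Filter.liminf (fun n : ℕ =>
          ⨅ x : X, (1 / ((wordBall S n).ncard : ℝ)) *
            ∑ᶠ g ∈ wordBall S n, A.indicator (fun _ => (1 : ℝ)) (g • x)) atTop := by
  classical
  let B : ℕ → Finset Γ := fun n => (finite_wordBall hfin n).toFinset
  have hBcard : ∀ n, (wordBall S n).ncard = (B n).card := fun n =>
    Set.ncard_eq_toFinset_card _ (finite_wordBall hfin n)
  have hBne : ∀ n, (B n).Nonempty := fun n => ⟨1, by simpa [B] using one_mem_wordBall S n⟩
  have hprob : ∀ n (x : X), IsProbabilityMeasure (orbitMeasure (B n) x) := fun n x =>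
    isProbabilityMeasure_orbitMeasure (hBne n) x
  have hdensity : ∀ n (x : X), (1 / ((wordBall S n).ncard : ℝ)) *
      ∑ᶠ g ∈ wordBall S n, A.indicator (fun _ => (1 : ℝ)) (g • x) =
        (orbitMeasure (B n) x A).toReal := by
    intro n x
    rw [toReal_orbitMeasure_apply _ _ hA.measurableSet, hBcard,
      finsum_mem_eq_finite_toFinset_sum _ (finite_wordBall hfin n)]
  simp only [hdensity]
  set u : ℕ → ℝ := fun n => ⨅ x : X, (orbitMeasure (B n) x A).toReal
  have hu_bdd : IsBoundedUnder (· ≤ ·) atTop u := by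
    refine isBoundedUnder_of ⟨1, fun n => ?_⟩
    obtain ⟨x⟩ := ‹Nonempty X›
    refine (ciInf_le ⟨0, ?_⟩ x).trans ?_
    · rintro _ ⟨y, rfl⟩
      exact ENNReal.toReal_nonneg
    · exact measureReal_le_one
  obtain ⟨φ, hφ, hφu⟩ := extraction_forall_of_frequently (P := fun k n =>
      u n < liminf u atTop + 1 / ((k : ℝ) + 1)) fun k =>
    frequently_lt_of_liminf_lt hu_bdd.isCoboundedUnder_ge
      (lt_add_of_pos_right _ (by positivity))
  choose x hx using fun k => exists_lt_of_ciInf_lt (hφu k)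
  let μ : ℕ → ProbabilityMeasure X := fun k => ⟨orbitMeasure (B (φ k)) (x k), hprob _ _⟩
  let l : Ultrafilter ℕ := Filter.hyperfilter ℕ
  have hl : (l : Filter ℕ) ≤ atTop := Nat.hyperfilter_le_atTop
  obtain ⟨ν, hν⟩ : ∃ ν, Tendsto μ l (𝓝 ν) := by
    obtain ⟨ν, -, hν⟩ := isCompact_univ.ultrafilter_le_nhds (l.map μ) (by simp)
    exact ⟨ν, hν⟩
  refine ⟨ν, inferInstance, fun g => ?_, ?_⟩
  · have hg : g ∈ Subgroup.closure S := hgen ▸ Subgroup.mem_top g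
    have hmeas : ∀ h : Γ, Measurable fun y : X => h • y := fun h => (hcont h).measurable
    induction hg using Subgroup.closure_induction with
    | mem s hs =>
      refine map_smul_eq_of_tendsto_orbitMeasure (μ := μ) (fun _ => rfl) hν (hcont s) ?_
      have hlim := (tendsto_ncard_layer_div hfin hsym hpoly).comp (hφ.tendsto_atTop.mono_left hl)
      refine squeeze_zero' (Eventually.of_forall fun _ => by positivity) ?_ hlim
      have hpos : ∀ᶠ k in (l : Filter ℕ), 1 ≤ φ k :=
        (hφ.tendsto_atTop.mono_left hl).eventually (eventually_ge_atTop 1)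
      filter_upwards [hpos] with k hk
      simp only [Function.comp_apply, hBcard]
      gcongr
      rw [← Set.ncard_coe_finset]
      refine Set.ncard_le_ncard ?_ (finite_wordBall hfin _).sdiff
      intro g hg
      simp only [B, Finset.coe_sdiff, Finset.coe_image, Set.Finite.coe_toFinset] at hg
      exact ⟨hg.1, fun h => hg.2 (mem_image_mul_left_of_mem_wordBall hsym hs hk h)⟩
    | one => simp
    | mul a b _ _ ha hb =>
      simp only [mul_smul]
      rw [← Function.comp_def (fun y : X => a • y), ← Measure.map_map (hmeas a) (hmeas b), hb, ha]
    | inv a _ ha =>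
      conv_lhs => rw [← ha]
      rw [Measure.map_map (hmeas _) (hmeas _)]
      simp [Function.comp_def]
  · have hbound : Tendsto (fun k : ℕ => liminf u atTop + 1 / ((k : ℝ) + 1)) l
        (𝓝 (liminf u atTop)) := by
      simpa using (tendsto_one_div_add_atTop_nhds_zero_nat.mono_left hl).const_add (liminf u atTop)
    have hliminf := ProbabilityMeasure.le_liminf_measure_open_of_tendsto hν hA
    have hle : (ν : Measure X) A ≤ ENNReal.ofReal (liminf u atTop) := by
      refine hliminf.trans ?_
      rw [← ((ENNReal.continuous_ofReal.tendsto _).comp hbound).liminf_eq]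
      refine liminf_le_liminf (Eventually.of_forall fun k => ?_)
      exact (ENNReal.le_ofReal_iff_toReal_le (measure_ne_top _ _)
        (ENNReal.toReal_nonneg.trans (hx k).le)).2 (hx k).le
    refine ENNReal.toReal_le_of_le_ofReal ?_ hle
    refine ge_of_tendsto hbound (Eventually.of_forall fun k => ?_)
    exact ENNReal.toReal_nonneg.trans (hx k).le
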